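/- arXiv:2601.09204 — 3 statements merged into one kernel-verified Lean document; each statement's English description precedes it below -/
import Mathlib

section
/- Let v : ℕ → ℕ satisfy v(n) ≥ c₀·log n for some constant c₀ > 0 and all sufficiently large n. Then for every M > 0 there exist C > 0 and N such that for all n ≥ N and all t ∈ ℝ with |t| ≤ M·(log n)^{1/4}, writing h_n = h_n(t), one has | v·τ_n(κ_n) − ( 2n + v + 2 s_n h_n² + log( v^{2n+v+1/2} / (2^{2n+v}·(n+v)^{n+v}·n^n·√s_n) ) ) | ≤ C·(log log s_n)/(log s_n). -/
open Filter Topology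

noncomputable section

/-- `s_n = 4n(n+v)/(2n+v)`. -/
def sSeq (v : ℕ → ℕ) (n : ℕ) : ℝ := 4 * n * (n + v n) / (2 * n + v n)

/-- `γ_n = (1/2) log s_n − (5/4) log log s_n − log (2^{1/4} π)`. -/
def gammaSeq (v : ℕ → ℕ) (n : ℕ) : ℝ :=
  (1/2) * Real.log (sSeq v n) - (5/4) * Real.log (Real.log (sSeq v n)) -
    Real.log ((2:ℝ) ^ ((1:ℝ)/4) * Real.pi)

/-- `h_n(t) = (γ_n + t)/√(2 s_n log s_n)`. -/
def hSeq (v : ℕ → ℕ) (n : ℕ) (t : ℝ) : ℝ :=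
  (gammaSeq v n + t) / Real.sqrt (2 * sSeq v n * Real.log (sSeq v n))

/-- `τ_n(r) = √(1+r²) − log(1+√(1+r²)) + (1/(4v)) log(1+r²) − ((2n+1)/v) log r`. -/
def tauFun (v : ℕ → ℕ) (n : ℕ) (r : ℝ) : ℝ :=
  Real.sqrt (1 + r ^ 2) - Real.log (1 + Real.sqrt (1 + r ^ 2)) +
    (1 / (4 * (v n : ℝ))) * Real.log (1 + r ^ 2) -
    ((2 * (n : ℝ) + 1) / (v n : ℝ)) * Real.log r

/-- `κ_n = (2√(n(n+v))/v)(1+h_n)²`. -/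
def kappaSeq (v : ℕ → ℕ) (n : ℕ) (t : ℝ) : ℝ :=
  (2 * Real.sqrt ((n : ℝ) * ((n : ℝ) + v n)) / (v n : ℝ)) * (1 + hSeq v n t) ^ 2

/-- If `|g'(x)| ≤ B` for `|x| ≤ |w|` and `g 0 = 0`,
then `|g w| ≤ B |w|`. -/
theorem abs_le_mul_abs_of_abs_deriv_le {g g' : ℝ → ℝ} {B w : ℝ}
    (hg : ∀ x, |x| ≤ |w| → HasDerivAt g (g' x) x) (hB : ∀ x, |x| ≤ |w| → |g' x| ≤ B)
    (h0 : g 0 = 0) : |g w| ≤ B * |w| := by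
  have hconv : Convex ℝ (Set.Icc (-|w|) |w|) := convex_Icc _ _
  have h := hconv.norm_image_sub_le_of_norm_hasDerivWithin_le (f := g) (f' := g') (C := B)
    (x := 0) (y := w)
    (fun x hx => (hg x (abs_le.2 hx)).hasDerivWithinAt) (fun x hx => hB x (abs_le.2 hx))
    (abs_le.1 (by simp)) (abs_le.1 le_rfl)
  simpa [h0] using h

/-- The function `w ↦ √(1 + a² e^{2w})`. -/
def expSqrt (a w : ℝ) : ℝ := Real.sqrt (1 + a ^ 2 * Real.exp (2 * w))

theorem expSqrt_sq (a w : ℝ) : expSqrt a w ^ 2 = 1 + a ^ 2 * Real.exp (2 * w) :=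
  Real.sq_sqrt (by positivity)

theorem expSqrt_pos (a w : ℝ) : 0 < expSqrt a w := Real.sqrt_pos.2 (by positivity)

theorem hasDerivAt_expSqrt (a w : ℝ) :
    HasDerivAt (expSqrt a) (a ^ 2 * Real.exp (2 * w) / expSqrt a w) w := by
  have h1 : HasDerivAt (fun w : ℝ => 1 + a ^ 2 * Real.exp (2 * w))
      (a ^ 2 * (Real.exp (2 * w) * 2)) w := by
    have h2 : HasDerivAt (fun w : ℝ => 2 * w) 2 w := by
      simpa using (hasDerivAt_id w).const_mul 2
    exact (h2.exp.const_mul _).const_add _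
  have h3 := h1.sqrt (by positivity)
  refine h3.congr_deriv ?_
  change _ / (2 * expSqrt a w) = _
  have := (expSqrt_pos a w).ne'
  field_simp

theorem expSqrt_le_exp_mul (a w : ℝ) : expSqrt a w ≤ Real.exp |w| * expSqrt a 0 := by
  refine le_of_sq_le_sq ?_ (by have := expSqrt_pos a 0; positivity)
  rw [mul_pow, expSqrt_sq, expSqrt_sq, ← Real.exp_nat_mul]
  have h1 : Real.exp (2 * w) ≤ Real.exp ((2 : ℕ) * |w|) :=
    Real.exp_le_exp.2 (by push_cast; linarith [le_abs_self w])
  have h2 : 1 ≤ Real.exp ((2 : ℕ) * |w|) := Real.one_le_exp (by positivity)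
  have := mul_le_mul_of_nonneg_left h1 (sq_nonneg a)
  simp only [mul_zero, Real.exp_zero]
  nlinarith

theorem expSqrt_zero_le_exp_mul (a w : ℝ) : expSqrt a 0 ≤ Real.exp |w| * expSqrt a w := by
  refine le_of_sq_le_sq ?_ (by have := expSqrt_pos a w; positivity)
  rw [mul_pow, expSqrt_sq, expSqrt_sq, ← Real.exp_nat_mul]
  have h1 : 1 ≤ Real.exp ((2 : ℕ) * |w|) * Real.exp (2 * w) := by
    rw [← Real.exp_add]
    exact Real.one_le_exp (by push_cast; linarith [neg_abs_le w])
  have h2 : 1 ≤ Real.exp ((2 : ℕ) * |w|) := Real.one_le_exp (by positivity)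
  have := mul_le_mul_of_nonneg_left h1 (sq_nonneg a)
  simp only [mul_zero, Real.exp_zero]
  nlinarith

/-- The logarithmic derivative of `√(1 + a² e^{2w})` varies slowly near `w = 0`. -/
theorem abs_deriv_expSqrt_sub_le {a w : ℝ} (hw : |w| ≤ 1 / 3) :
    |a ^ 2 * Real.exp (2 * w) / expSqrt a w - a ^ 2 / expSqrt a 0| ≤
      6 * (a ^ 2 / expSqrt a 0) * |w| := by
  have hS := expSqrt_pos a w
  have hS0 := expSqrt_pos a 0
  have hA : 0 ≤ a ^ 2 / expSqrt a 0 := by positivity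
  have hexp : |Real.exp (3 * |w|) - 1| ≤ 2 * abs (3 * |w|) :=
    Real.abs_exp_sub_one_le (by rw [abs_of_nonneg (by positivity)]; linarith)
  have hexp' : |Real.exp (-(3 * |w|)) - 1| ≤ 2 * abs (-(3 * |w|)) :=
    Real.abs_exp_sub_one_le (by rw [abs_neg, abs_of_nonneg (by positivity)]; linarith)
  rw [abs_neg] at hexp'
  rw [abs_of_nonneg (by positivity : 0 ≤ 3 * |w|)] at hexp hexp'
  have hratio : |Real.exp (2 * w) * (expSqrt a 0 / expSqrt a w) - 1| ≤ 6 * |w| := by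
    have hq1 : expSqrt a 0 / expSqrt a w ≤ Real.exp |w| :=
      (div_le_iff₀ hS).2 (expSqrt_zero_le_exp_mul a w)
    have hq2 : Real.exp (-|w|) ≤ expSqrt a 0 / expSqrt a w := by
      rw [le_div_iff₀ hS, Real.exp_neg, inv_mul_le_iff₀ (Real.exp_pos _)]
      exact expSqrt_le_exp_mul a w
    have hu : Real.exp (2 * w) * (expSqrt a 0 / expSqrt a w) ≤ Real.exp (3 * |w|) := by
      calc _ ≤ Real.exp (2 * |w|) * Real.exp |w| := by
            gcongr
            exact le_abs_self w
        _ = _ := by rw [← Real.exp_add]; ring_nf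
    have hl : Real.exp (-(3 * |w|)) ≤ Real.exp (2 * w) * (expSqrt a 0 / expSqrt a w) := by
      calc _ = Real.exp (-(2 * |w|)) * Real.exp (-|w|) := by rw [← Real.exp_add]; ring_nf
        _ ≤ _ := by
            gcongr
            linarith [neg_abs_le w]
    rw [abs_le] at hexp hexp' ⊢
    constructor <;> linarith
  have : a ^ 2 * Real.exp (2 * w) / expSqrt a w - a ^ 2 / expSqrt a 0 =
      a ^ 2 / expSqrt a 0 * (Real.exp (2 * w) * (expSqrt a 0 / expSqrt a w) - 1) := by
    field_simp
  rw [this, abs_mul, abs_of_nonneg hA]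
  nlinarith

theorem abs_expSqrt_sub_le {a w : ℝ} (hw : |w| ≤ 1 / 3) :
    |expSqrt a w - expSqrt a 0 - a ^ 2 / expSqrt a 0 * w| ≤
      6 * (a ^ 2 / expSqrt a 0) * w ^ 2 := by
  have hS0 := expSqrt_pos a 0
  have h := abs_le_mul_abs_of_abs_deriv_le (w := w)
    (g := fun x => expSqrt a x - expSqrt a 0 - a ^ 2 / expSqrt a 0 * x)
    (g' := fun x => a ^ 2 * Real.exp (2 * x) / expSqrt a x - a ^ 2 / expSqrt a 0)
    (B := 6 * (a ^ 2 / expSqrt a 0) * |w|)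
    (fun x _ => by
      exact (((hasDerivAt_expSqrt a x).sub_const (expSqrt a 0)).sub
        ((hasDerivAt_id x).const_mul (a ^ 2 / expSqrt a 0))).congr_deriv (by simp))
    (fun x hx => (abs_deriv_expSqrt_sub_le (hx.trans hw)).trans (by gcongr))
    (by simp)
  rw [mul_assoc, ← sq, sq_abs] at h
  exact h

/-- The phase `v τ(a e^w)`, up to the additive constant `-(2n+1) log a`. -/
def phase (n v a w : ℝ) : ℝ :=
  v * (expSqrt a w - Real.log (1 + expSqrt a w)) +
    1 / 4 * Real.log (1 + a ^ 2 * Real.exp (2 * w)) - (2 * n + 1) * w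

theorem hasDerivAt_phase (n v a w : ℝ) :
    HasDerivAt (phase n v a)
      (v * (expSqrt a w - 1) +
        1 / 2 * (a ^ 2 * Real.exp (2 * w) / (1 + a ^ 2 * Real.exp (2 * w))) - (2 * n + 1)) w := by
  have hS := expSqrt_pos a w
  have hd := hasDerivAt_expSqrt a w
  have h1 := (hd.sub ((hd.const_add 1).log (by positivity))).const_mul v
  have h2 : HasDerivAt (fun w : ℝ => 1 + a ^ 2 * Real.exp (2 * w))
      (a ^ 2 * (Real.exp (2 * w) * 2)) w := by
    have h2 : HasDerivAt (fun w : ℝ => 2 * w) 2 w := by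
      simpa using (hasDerivAt_id w).const_mul 2
    exact (h2.exp.const_mul _).const_add _
  have h3 := (h2.log (by positivity)).const_mul (1 / 4)
  have h4 := (h1.add h3).sub ((hasDerivAt_id w).const_mul (2 * n + 1))
  refine h4.congr_deriv ?_
  have hsq : a ^ 2 * Real.exp (2 * w) = expSqrt a w ^ 2 - 1 := by rw [expSqrt_sq]; ring
  have e1 : a ^ 2 * Real.exp (2 * w) / expSqrt a w -
      a ^ 2 * Real.exp (2 * w) / expSqrt a w / (1 + expSqrt a w) = expSqrt a w - 1 := by
    rw [hsq]
    field_simp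
    ring
  rw [e1]
  ring

/-- Second-order expansion of the phase around its approximate critical point. -/
theorem abs_phase_sub_le {n v a w : ℝ} (hv : 0 < v) (ha : v * (expSqrt a 0 - 1) = 2 * n)
    (hw : |w| ≤ 1 / 3) :
    |phase n v a w - phase n v a 0 - v * (a ^ 2 / expSqrt a 0) * w ^ 2 / 2| ≤
      (1 + 6 * (v * (a ^ 2 / expSqrt a 0)) * w ^ 2) * |w| := by
  have hS0 := expSqrt_pos a 0
  refine abs_le_mul_abs_of_abs_deriv_le (w := w)
    (g := fun x => phase n v a x - phase n v a 0 - v * (a ^ 2 / expSqrt a 0) * x ^ 2 / 2)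
    (g' := fun x => v * (expSqrt a x - 1) +
        1 / 2 * (a ^ 2 * Real.exp (2 * x) / (1 + a ^ 2 * Real.exp (2 * x))) - (2 * n + 1) -
        v * (a ^ 2 / expSqrt a 0) * x) (fun x _ => ?_) (fun x hx => ?_) (by simp)
  · have h := ((hasDerivAt_phase n v a x).sub_const (phase n v a 0)).sub
      ((((hasDerivAt_id x).pow 2).const_mul (v * (a ^ 2 / expSqrt a 0))).div_const 2)
    refine h.congr_deriv ?_
    simp
    ring
  · have h := abs_expSqrt_sub_le (a := a) (hx.trans hw)
    have hx2 : x ^ 2 ≤ w ^ 2 := sq_le_sq.2 hx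
    have h' : |v * (expSqrt a x - expSqrt a 0 - a ^ 2 / expSqrt a 0 * x)| ≤
        6 * (v * (a ^ 2 / expSqrt a 0)) * w ^ 2 := by
      rw [abs_mul, abs_of_pos hv]
      calc _ ≤ v * (6 * (a ^ 2 / expSqrt a 0) * x ^ 2) := by gcongr
        _ ≤ v * (6 * (a ^ 2 / expSqrt a 0) * w ^ 2) := by gcongr
        _ = _ := by ring
    have hq0 : 0 ≤ a ^ 2 * Real.exp (2 * x) / (1 + a ^ 2 * Real.exp (2 * x)) := by positivity
    have hq1 : a ^ 2 * Real.exp (2 * x) / (1 + a ^ 2 * Real.exp (2 * x)) ≤ 1 :=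
      (div_le_one (by positivity)).2 (by linarith)
    rw [abs_le] at h' ⊢
    constructor <;> linarith

theorem abs_two_mul_log_one_add_sub_le {h : ℝ} (hh : |h| ≤ 1 / 2) :
    |2 * Real.log (1 + h) - 2 * h| ≤ 4 * h ^ 2 := by
  have hh' := abs_le.1 hh
  have hpos : 0 < 1 + h := by linarith
  have h1 := Real.log_le_sub_one_of_pos hpos
  have h2 := Real.one_sub_inv_le_log_of_pos hpos
  have h3 : 1 - (1 + h)⁻¹ = h - h ^ 2 / (1 + h) := by
    field_simp
    ring
  have h4 : h ^ 2 / (1 + h) ≤ 2 * h ^ 2 := by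
    rw [div_le_iff₀ hpos]
    nlinarith [sq_nonneg h]
  rw [abs_le]
  constructor <;> nlinarith [sq_nonneg h]

theorem abs_phase_log_sub_le {n v a s h : ℝ} (hv : 0 < v) (ha : v * (expSqrt a 0 - 1) = 2 * n)
    (hs : v * (a ^ 2 / expSqrt a 0) = s) (hh : |h| ≤ 1 / 12) :
    |phase n v a (2 * Real.log (1 + h)) - phase n v a 0 - 2 * s * h ^ 2| ≤
      4 * |h| + 400 * (s * h ^ 2) * |h| := by
  have hs0 : 0 ≤ s := by
    have := expSqrt_pos a 0
    rw [← hs]; positivity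
  have h1 := abs_two_mul_log_one_add_sub_le (h := h) (by linarith)
  set w := 2 * Real.log (1 + h)
  have hsq : h ^ 2 = |h| * |h| := by rw [← sq, sq_abs]
  have h0 := abs_nonneg h
  have hsmall : 4 * h ^ 2 ≤ 2 * |h| := by rw [hsq]; nlinarith
  have hw : |w| ≤ 4 * |h| := by
    have : |w| ≤ |w - 2 * h| + |2 * h| := by simpa using abs_add_le (w - 2 * h) (2 * h)
    rw [abs_mul 2 h, abs_two] at this
    linarith
  have h2 := abs_phase_sub_le (w := w) hv ha (by linarith)
  rw [hs] at h2
  have hw2 : w ^ 2 ≤ 16 * h ^ 2 := by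
    rw [← sq_abs w, ← sq_abs h]
    nlinarith [abs_nonneg w]
  have h3 : (1 + 6 * s * w ^ 2) * |w| ≤ (1 + 6 * s * (16 * h ^ 2)) * (4 * |h|) := by gcongr
  have h4 : |s * w ^ 2 / 2 - 2 * s * h ^ 2| ≤ 12 * (s * h ^ 2) * |h| := by
    have e : s * w ^ 2 / 2 - 2 * s * h ^ 2 = s / 2 * ((w - 2 * h) * (w + 2 * h)) := by ring
    have h5 : |w + 2 * h| ≤ 6 * |h| := by
      have := abs_add_le w (2 * h)
      rw [abs_mul 2 h, abs_two] at this
      linarith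
    rw [e, abs_mul, abs_mul, abs_of_nonneg (by positivity : 0 ≤ s / 2)]
    calc _ ≤ s / 2 * (4 * h ^ 2 * (6 * |h|)) := by gcongr
      _ = _ := by ring
  have h6 := abs_add_le (phase n v a w - phase n v a 0 - s * w ^ 2 / 2)
    (s * w ^ 2 / 2 - 2 * s * h ^ 2)
  have e : phase n v a w - phase n v a 0 - s * w ^ 2 / 2 + (s * w ^ 2 / 2 - 2 * s * h ^ 2) =
    phase n v a w - phase n v a 0 - 2 * s * h ^ 2 := by ring
  rw [e] at h6
  have : 0 ≤ s * h ^ 2 * |h| := by positivity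
  nlinarith

/-- The unperturbed argument `2√(n(n+v))/v`. -/
def kappaBase (n v : ℝ) : ℝ := 2 * Real.sqrt (n * (n + v)) / v

theorem kappaBase_sq {n v : ℝ} (hn : 0 < n) (hv : 0 < v) :
    kappaBase n v ^ 2 = 4 * (n * (n + v)) / v ^ 2 := by
  rw [kappaBase, div_pow, mul_pow, Real.sq_sqrt (by positivity)]
  norm_num

theorem expSqrt_kappaBase_zero {n v : ℝ} (hn : 0 < n) (hv : 0 < v) :
    expSqrt (kappaBase n v) 0 = (2 * n + v) / v := by
  rw [expSqrt, kappaBase_sq hn hv, mul_zero, Real.exp_zero,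
    show 1 + 4 * (n * (n + v)) / v ^ 2 * 1 = ((2 * n + v) / v) ^ 2 by field_simp; ring,
    Real.sqrt_sq (by positivity)]

theorem phase_kappaBase_zero {n v : ℝ} (hn : 0 < n) (hv : 0 < v) :
    phase n v (kappaBase n v) 0 - (2 * n + 1) * Real.log (kappaBase n v) =
      2 * n + v + Real.log (v ^ (2 * n + v + 1 / 2) /
        (2 ^ (2 * n + v) * (n + v) ^ (n + v) * n ^ n *
          Real.sqrt (4 * n * (n + v) / (2 * n + v)))) := by
  have hnv : 0 < n + v := by positivity
  have h2nv : 0 < 2 * n + v := by positivity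
  have e1 : 1 + (2 * n + v) / v = 2 * (n + v) / v := by field_simp; ring
  have e2 : 1 + kappaBase n v ^ 2 * Real.exp (2 * 0) = ((2 * n + v) / v) ^ 2 := by
    rw [← expSqrt_sq, expSqrt_kappaBase_zero hn hv]
  have hk : Real.log (kappaBase n v) =
      Real.log 2 + (Real.log n + Real.log (n + v)) / 2 - Real.log v := by
    rw [kappaBase, Real.log_div (by positivity) hv.ne', Real.log_mul two_ne_zero (by positivity),
      Real.log_sqrt (by positivity), Real.log_mul hn.ne' hnv.ne']
  have hs : Real.log (Real.sqrt (4 * n * (n + v) / (2 * n + v))) =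
      (2 * Real.log 2 + Real.log n + Real.log (n + v) - Real.log (2 * n + v)) / 2 := by
    rw [Real.log_sqrt (by positivity), Real.log_div (by positivity) h2nv.ne',
      Real.log_mul (by positivity) hnv.ne', Real.log_mul (by positivity) hn.ne',
      show (4 : ℝ) = 2 ^ 2 by norm_num, Real.log_pow]
    push_cast
    ring
  have hlog : Real.log (v ^ (2 * n + v + 1 / 2) /
        (2 ^ (2 * n + v) * (n + v) ^ (n + v) * n ^ n *
          Real.sqrt (4 * n * (n + v) / (2 * n + v)))) =
      (2 * n + v + 1 / 2) * Real.log v - ((2 * n + v) * Real.log 2 +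
        (n + v) * Real.log (n + v) + n * Real.log n + (2 * Real.log 2 + Real.log n +
          Real.log (n + v) - Real.log (2 * n + v)) / 2) := by
    rw [Real.log_div (by positivity) (by positivity), Real.log_mul (by positivity) (by positivity),
      Real.log_mul (by positivity) (by positivity), Real.log_mul (by positivity) (by positivity),
      hs, Real.log_rpow hv, Real.log_rpow two_pos, Real.log_rpow hnv, Real.log_rpow hn]
  rw [hlog, phase, e2, expSqrt_kappaBase_zero hn hv, e1, hk, Real.log_pow,
    Real.log_div (by positivity) hv.ne', Real.log_div (by positivity) hv.ne',
    Real.log_mul two_ne_zero hnv.ne']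
  field_simp
  push_cast
  ring

theorem mul_tauFun_eq_phase {v : ℕ → ℕ} {n : ℕ} (hn : 0 < n) (hv : 0 < v n) {h : ℝ}
    (hh : 0 < 1 + h) :
    (v n : ℝ) * tauFun v n (kappaBase n (v n) * (1 + h) ^ 2) =
      phase n (v n) (kappaBase n (v n)) (2 * Real.log (1 + h)) -
        (2 * n + 1) * Real.log (kappaBase n (v n)) := by
  have hv' : (0 : ℝ) < v n := by exact_mod_cast hv
  have hn' : (0 : ℝ) < n := by exact_mod_cast hn
  have hk : 0 < kappaBase n (v n) := by rw [kappaBase]; positivity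
  have e : kappaBase n (v n) ^ 2 * Real.exp (2 * (2 * Real.log (1 + h))) =
      (kappaBase n (v n) * (1 + h) ^ 2) ^ 2 := by
    have : Real.exp (2 * (2 * Real.log (1 + h))) = (1 + h) ^ 4 := by
      rw [show 2 * (2 * Real.log (1 + h)) = (4 : ℕ) * Real.log (1 + h) by push_cast; ring,
        Real.exp_nat_mul, Real.exp_log hh]
    rw [this]
    ring
  rw [phase, expSqrt, e, tauFun, Real.log_mul hk.ne' (by positivity), Real.log_pow]
  field_simp
  push_cast
  ring

theorem abs_hSeq_le {v : ℕ → ℕ} {n : ℕ} {t M : ℝ} (hM : 0 < M) (hs : 0 < sSeq v n)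
    (hL : 1 ≤ Real.log (sSeq v n))
    (hc : |Real.log ((2:ℝ) ^ ((1:ℝ)/4) * Real.pi)| ≤ Real.log (sSeq v n))
    (ht : |t| ≤ M * Real.log (sSeq v n)) :
    |hSeq v n t| ≤ (3 + M) * Real.sqrt (Real.log (sSeq v n) / sSeq v n) := by
  set s := sSeq v n with hsdef
  set L := Real.log s with hLdef
  have hL0 : 0 < L := by linarith
  have hll : |Real.log L| ≤ L := by
    rw [abs_of_nonneg (Real.log_nonneg hL)]
    linarith [Real.log_le_sub_one_of_pos hL0]
  have hnum : |gammaSeq v n + t| ≤ (3 + M) * L := by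
    rw [gammaSeq, ← hsdef, ← hLdef]
    rw [abs_le] at hc ht hll ⊢
    constructor <;> linarith
  have hden : L / Real.sqrt (L / s) ≤ Real.sqrt (2 * s * L) := by
    rw [div_le_iff₀ (by positivity), ← Real.sqrt_mul (by positivity)]
    refine Real.le_sqrt_of_sq_le ?_
    have : 2 * s * L * (L / s) = 2 * L ^ 2 := by field_simp
    rw [this]
    nlinarith [sq_nonneg L]
  have hq : 0 < Real.sqrt (L / s) := Real.sqrt_pos.2 (by positivity)
  rw [hSeq, ← hsdef, ← hLdef, abs_div, abs_of_nonneg (Real.sqrt_nonneg _),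
    div_le_iff₀ (by positivity)]
  calc _ ≤ (3 + M) * L := hnum
    _ = (3 + M) * Real.sqrt (L / s) * (L / Real.sqrt (L / s)) := by field_simp
    _ ≤ _ := by gcongr

theorem natCast_le_sSeq {v : ℕ → ℕ} {n : ℕ} (hn : 0 < n) : (n : ℝ) ≤ sSeq v n := by
  have hn' : (0 : ℝ) < n := by exact_mod_cast hn
  have hv' : (0 : ℝ) ≤ v n := Nat.cast_nonneg _
  rw [sSeq, le_div_iff₀ (by positivity)]
  nlinarith [mul_nonneg hn'.le hv']

theorem eventually_pow_log_le (k : ℕ) : ∀ᶠ x : ℝ in atTop, Real.log x ^ k ≤ x := by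
  filter_upwards [(Real.isLittleO_pow_log_id_atTop (n := k)).bound one_pos, eventually_ge_atTop 0]
    with x hx h0
  rw [one_mul, Real.norm_eq_abs, id, Real.norm_eq_abs, abs_of_nonneg h0] at hx
  exact (le_abs_self _).trans hx

/-- Precise asymptotics for `v·τ_n(κ_n)` in the regime `v ≳ log n`. -/
theorem v_tau_kappa_asymptotics
    (v : ℕ → ℕ) (c₀ : ℝ) (hc₀ : 0 < c₀)
    (hv : ∀ᶠ n : ℕ in atTop, c₀ * Real.log n ≤ (v n : ℝ)) :
    ∀ M > 0, ∃ C > 0, ∃ N : ℕ, ∀ n ≥ N, ∀ t : ℝ,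
      |t| ≤ M * Real.log n ^ ((1:ℝ)/4) →
      |(v n : ℝ) * tauFun v n (kappaSeq v n t) -
        (2 * n + v n + 2 * sSeq v n * hSeq v n t ^ 2 +
          Real.log ((v n : ℝ) ^ (2 * (n : ℝ) + v n + 1/2) /
            ((2:ℝ) ^ (2 * (n : ℝ) + v n) * ((n : ℝ) + v n) ^ ((n : ℝ) + v n) *
              (n : ℝ) ^ (n : ℝ) * Real.sqrt (sSeq v n))))| ≤
      C * Real.log (Real.log (sSeq v n)) / Real.log (sSeq v n) := by
  intro M hM
  set K := 3 + M
  have hK0 : 0 < K := by positivity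
  refine ⟨4 * K + 400 * K ^ 3, by positivity, ?_⟩
  have hlarge : ∀ᶠ x : ℝ in atTop, Real.log x ^ 5 ≤ x ∧ Real.exp 1 ≤ Real.log x ∧
      |Real.log ((2:ℝ) ^ ((1:ℝ)/4) * Real.pi)| ≤ Real.log x ∧ 12 * K ≤ Real.log x :=
    (eventually_pow_log_le 5).and <| (Real.tendsto_log_atTop.eventually_ge_atTop _).and <|
      (Real.tendsto_log_atTop.eventually_ge_atTop _).and <|
        Real.tendsto_log_atTop.eventually_ge_atTop _
  obtain ⟨X, hX⟩ := eventually_atTop.1 hlarge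
  have hlogn : ∀ᶠ n : ℕ in atTop, 1 ≤ Real.log n :=
    (Real.tendsto_log_atTop.comp tendsto_natCast_atTop_atTop).eventually_ge_atTop 1
  have hnX : ∀ᶠ n : ℕ in atTop, X ≤ (n : ℝ) := tendsto_natCast_atTop_atTop.eventually_ge_atTop X
  obtain ⟨N, hN⟩ := eventually_atTop.1 (hv.and (hlogn.and (hnX.and (eventually_gt_atTop 0))))
  refine ⟨N, fun n hn t ht => ?_⟩
  obtain ⟨hvn, hlog, hXn, hn0⟩ := hN n hn
  have hn' : (0 : ℝ) < n := by exact_mod_cast hn0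
  have hv' : (0 : ℝ) < v n := lt_of_lt_of_le (by positivity) hvn
  have hns := natCast_le_sSeq (v := v) hn0
  obtain ⟨hL5, hLe, hLc, hLK⟩ := hX _ (hXn.trans hns)
  have hs0 : 0 < sSeq v n := hn'.trans_le hns
  have hL1 : 1 ≤ Real.log (sSeq v n) := hlog.trans (Real.log_le_log hn' hns)
  have ht' : |t| ≤ M * Real.log (sSeq v n) := by
    refine ht.trans ?_
    gcongr
    calc Real.log n ^ ((1:ℝ)/4) ≤ Real.log n ^ (1:ℝ) :=
          Real.rpow_le_rpow_of_exponent_le hlog (by norm_num)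
      _ = Real.log n := Real.rpow_one _
      _ ≤ _ := Real.log_le_log hn' hns
  have hh := abs_hSeq_le hM hs0 hL1 hLc ht'
  have hS : v n * (kappaBase n (v n) ^ 2 / expSqrt (kappaBase n (v n)) 0) = sSeq v n := by
    rw [kappaBase_sq hn' hv', expSqrt_kappaBase_zero hn' hv', sSeq]
    field_simp
  have hcrit : (v n : ℝ) * (expSqrt (kappaBase n (v n)) 0 - 1) = 2 * n := by
    rw [expSqrt_kappaBase_zero hn' hv']
    field_simp
    ring
  have hbase := phase_kappaBase_zero hn' hv'
  rw [show 4 * (n : ℝ) * (n + v n) / (2 * n + v n) = sSeq v n from rfl] at hbase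
  set s := sSeq v n
  set L := Real.log s
  set h := hSeq v n t
  set q := Real.sqrt (L / s)
  have hL0 : 0 < L := by linarith
  have hq0 : 0 ≤ q := Real.sqrt_nonneg _
  have hq2 : q ^ 2 = L / s := Real.sq_sqrt (by positivity)
  have hqL : L ^ 2 * q ≤ 1 := by
    refine le_of_sq_le_sq ?_ zero_le_one
    rw [mul_pow, hq2, one_pow, show (L ^ 2) ^ 2 * (L / s) = L ^ 5 / s by ring, div_le_one hs0]
    exact hL5
  have hh12 : |h| ≤ 1 / 12 := by
    have h1 : 12 * K * q ≤ L ^ 2 * q := by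
      gcongr
      exact hLK.trans (le_self_pow₀ hL1 two_ne_zero)
    linarith
  have hmain := abs_phase_log_sub_le hv' hcrit hS hh12
  have htau := mul_tauFun_eq_phase (v := v) hn0 (by exact_mod_cast hv')
    (h := h) (by linarith [(abs_le.1 hh12).1])
  have hsh : s * h ^ 2 ≤ K ^ 2 * L := by
    have : h ^ 2 ≤ (K * q) ^ 2 := by rw [← sq_abs h]; gcongr
    calc s * h ^ 2 ≤ s * (K * q) ^ 2 := by gcongr
      _ = K ^ 2 * L := by rw [mul_pow, hq2]; field_simp
  have hfinal : 4 * |h| + 400 * (s * h ^ 2) * |h| ≤ (4 * K + 400 * K ^ 3) * (L * q) := by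
    have h1 : s * h ^ 2 * |h| ≤ K ^ 2 * L * (K * q) := by gcongr
    have h2 : K * q ≤ K * (L * q) := by
      gcongr
      exact le_mul_of_one_le_left hq0 hL1
    calc 4 * |h| + 400 * (s * h ^ 2) * |h| = 4 * |h| + 400 * (s * h ^ 2 * |h|) := by ring
      _ ≤ 4 * (K * (L * q)) + 400 * (K ^ 2 * L * (K * q)) := by
          gcongr
          exact hh.trans h2
      _ = _ := by ring
  have hlogL : 1 ≤ Real.log L := (Real.le_log_iff_exp_le hL0).2 hLe
  have hbound : (4 * K + 400 * K ^ 3) * (L * q) ≤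
      (4 * K + 400 * K ^ 3) * Real.log L / L := by
    rw [mul_div_assoc]
    gcongr
    rw [le_div_iff₀ hL0]
    calc L * q * L = L ^ 2 * q := by ring
      _ ≤ 1 := hqL
      _ ≤ _ := hlogL
  refine le_trans (le_of_eq ?_) (hmain.trans (hfinal.trans hbound))
  rw [show kappaSeq v n t = kappaBase n (v n) * (1 + h) ^ 2 from rfl, htau]
  congr 1
  linarith
end
end

section
/- Let v : ℕ → ℕ satisfy v(n) ≥ c₀·log n for some constant c₀ > 0 and all sufficiently large n. Then for every M > 0 there exist C > 0 and N such that for all n ≥ N and all t ∈ ℝ with |t| ≤ M·(log n)^{1/4}, writing h_n = h_n(t) and w(r) = v·τ_n(κ_n(1+r)): (i) both w and its derivative w' are strictly increasing on [0, ∞); (ii) for all r > 0, w(r) ≥ v·τ_n(κ_n) + 2 s_n h_n r·(1 − C·h_n) and w'(r) ≥ 2 s_n h_n·(1 − C·h_n). -/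
open Filter Topology

noncomputable section

/-- The derivative of `y ↦ v τ_n(k y)` in closed form. -/
def scaledTauDeriv (m a k y : ℝ) : ℝ :=
  (m * √(1 + (k * y) ^ 2) - a - 1 / 2 - 1 / (2 * (1 + (k * y) ^ 2))) / y

theorem hasDerivAt_tauFun (v : ℕ → ℕ) (n : ℕ) {x : ℝ} (hx : 0 < x) :
    HasDerivAt (tauFun v n)
      (x / (1 + √(1 + x ^ 2)) + (1 / (4 * (v n : ℝ))) * (2 * x / (1 + x ^ 2)) -
        ((2 * (n : ℝ) + 1) / (v n : ℝ)) * x⁻¹) x := by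
  have hpos : 0 < 1 + x ^ 2 := by positivity
  have hq : HasDerivAt (fun x : ℝ => 1 + x ^ 2) (2 * x) x := by
    simpa using (hasDerivAt_pow 2 x).const_add 1
  have hS := hq.sqrt hpos.ne'
  have hSpos : 0 < √(1 + x ^ 2) := Real.sqrt_pos.2 hpos
  have hlog := (hS.const_add 1).log (by positivity)
  have key := ((hS.sub hlog).add ((hq.log hpos.ne').const_mul (1 / (4 * (v n : ℝ))))).sub
    ((Real.hasDerivAt_log hx.ne').const_mul ((2 * (n : ℝ) + 1) / (v n : ℝ)))
  refine key.congr_deriv ?_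
  congr 2
  field_simp
  ring

theorem hasDerivAt_scaled_tauFun (v : ℕ → ℕ) (n : ℕ) (hv : 0 < v n) {k r : ℝ} (hk : 0 < k)
    (hr : 0 < 1 + r) :
    HasDerivAt (fun r => (v n : ℝ) * tauFun v n (k * (1 + r)))
      (scaledTauDeriv (v n) (2 * n + v n) k (1 + r)) r := by
  have hm : (0 : ℝ) < v n := by exact_mod_cast hv
  have hx : 0 < k * (1 + r) := by positivity
  have hin : HasDerivAt (fun r : ℝ => k * (1 + r)) k r := by
    simpa using ((hasDerivAt_id r).const_add 1).const_mul k
  refine (((hasDerivAt_tauFun v n hx).comp r hin).const_mul (v n : ℝ)).congr_deriv ?_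
  have hpos : 0 < 1 + (k * (1 + r)) ^ 2 := by positivity
  have hsq : √(1 + (k * (1 + r)) ^ 2) ^ 2 = 1 + (k * (1 + r)) ^ 2 := Real.sq_sqrt hpos.le
  have hS : 0 ≤ √(1 + (k * (1 + r)) ^ 2) := Real.sqrt_nonneg _
  have hfrac : k * (1 + r) / (1 + √(1 + (k * (1 + r)) ^ 2)) =
      (√(1 + (k * (1 + r)) ^ 2) - 1) / (k * (1 + r)) := by
    rw [div_eq_div_iff (by positivity) (by positivity)]
    linear_combination -hsq
  rw [hfrac, scaledTauDeriv]
  generalize √(1 + (k * (1 + r)) ^ 2) = S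
  generalize 1 + r = y at *
  field_simp
  ring

theorem scaledTauDeriv_strictMonoOn {m a k : ℝ} (hm : 0 < m) (ha : m ≤ a) :
    StrictMonoOn (scaledTauDeriv m a k) (Set.Ioi 0) := by
  intro y hy z hz hyz
  rw [Set.mem_Ioi] at hy hz
  have hP : 0 < 1 + (k * y) ^ 2 := by positivity
  have hQ : 0 < 1 + (k * z) ^ 2 := by positivity
  have hPQ : 1 + (k * y) ^ 2 ≤ 1 + (k * z) ^ 2 := by
    rw [mul_pow, mul_pow]; gcongr
  have hroot : z * √(1 + (k * y) ^ 2) - y * √(1 + (k * z) ^ 2) ≤ z - y := by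
    have h1 : z * √(1 + (k * y) ^ 2) ≤ y * √(1 + (k * z) ^ 2) + (z - y) := by
      refine abs_le_of_sq_le_sq' ?_ ?_ |>.2
      · have h3 : 1 ≤ √(1 + (k * z) ^ 2) := Real.one_le_sqrt.2 (by nlinarith [sq_nonneg (k * z)])
        have h4 := Real.sq_sqrt hP.le
        have h5 := Real.sq_sqrt hQ.le
        have h6 : 0 ≤ y * (z - y) * (√(1 + (k * z) ^ 2) - 1) :=
          mul_nonneg (mul_nonneg hy.le (by linarith)) (by linarith)
        calc (z * √(1 + (k * y) ^ 2)) ^ 2 = z ^ 2 * (1 + (k * y) ^ 2) := by rw [mul_pow, h4]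
          _ ≤ y ^ 2 * (1 + (k * z) ^ 2) + 2 * (y * (z - y)) * √(1 + (k * z) ^ 2) +
              (z - y) ^ 2 := by nlinarith
          _ = _ := by linear_combination -y ^ 2 * h5
      · have := Real.sqrt_nonneg (1 + (k * z) ^ 2)
        have : 0 ≤ y * √(1 + (k * z) ^ 2) := by positivity
        linarith
    linarith
  have hinv : 1 / (2 * (1 + (k * z) ^ 2)) ≤ 1 / (2 * (1 + (k * y) ^ 2)) := by gcongr
  have hinv0 : 0 < 1 / (2 * (1 + (k * z) ^ 2)) := by positivity
  unfold scaledTauDeriv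
  rw [div_lt_div_iff₀ hy hz]
  have h1 := mul_le_mul_of_nonneg_left hroot hm.le
  have h2 := mul_le_mul_of_nonneg_left hinv hz.le
  have h3 : 0 < (z - y) * (1 / (2 * (1 + (k * z) ^ 2))) := mul_pos (by linarith) hinv0
  have h4 : 0 ≤ (a - m) * (z - y) := mul_nonneg (by linarith) (by linarith)
  nlinarith

theorem scaledTauDeriv_one_lower_bound {N m h : ℝ} (hN : 0 < N) (hm : 0 < m) (hh : 0 ≤ h) :
    2 * (4 * N * (N + m) / (2 * N + m)) * h - 1 ≤
      scaledTauDeriv m (2 * N + m) ((2 * √(N * (N + m)) / m) * (1 + h) ^ 2) 1 := by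
  have hA : 0 < 2 * N + m := by positivity
  set k := (2 * √(N * (N + m)) / m) * (1 + h) ^ 2 with hk
  set s := 4 * N * (N + m) / (2 * N + m) with hs
  have hs0 : 0 < s := by positivity
  have hsA : s * (2 * N + m) = 4 * N * (N + m) := by rw [hs]; field_simp
  have hsle : s ≤ 2 * N + m := by
    rw [hs, div_le_iff₀ hA]; nlinarith [sq_nonneg m]
  have hksq : m ^ 2 * k ^ 2 = 4 * N * (N + m) * (1 + h) ^ 4 := by
    have := Real.sq_sqrt (show 0 ≤ N * (N + m) by positivity)
    calc m ^ 2 * k ^ 2 = 4 * √(N * (N + m)) ^ 2 * (1 + h) ^ 4 := by rw [hk]; field_simp; ring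
      _ = _ := by rw [this]; ring
  have hroot : 2 * N + m + 2 * s * h ≤ m * √(1 + k ^ 2) := by
    refine abs_le_of_sq_le_sq' ?_ (by positivity) |>.2
    rw [mul_pow, Real.sq_sqrt (by positivity), mul_add, hksq, ← hsA]
    have h1 : s * s ≤ s * (2 * N + m) := mul_le_mul_of_nonneg_left hsle hs0.le
    have h2 := mul_le_mul_of_nonneg_right h1 (sq_nonneg h)
    have h3 : 0 ≤ s * (2 * N + m) * (2 * h ^ 2 + 4 * h ^ 3 + h ^ 4) := by positivity
    nlinarith
  have hinv : 1 / (2 * (1 + k ^ 2)) ≤ 1 / 2 := by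
    apply one_div_le_one_div_of_le (by norm_num)
    nlinarith [sq_nonneg k]
  unfold scaledTauDeriv
  rw [mul_one, div_one]
  linarith

theorem two_mul_le_sSeq (v : ℕ → ℕ) {n : ℕ} (hn : 0 < n) : 2 * (n : ℝ) ≤ sSeq v n := by
  have : (0 : ℝ) < n := by exact_mod_cast hn
  have hv : (0 : ℝ) ≤ v n := by positivity
  rw [sSeq, le_div_iff₀ (by positivity)]
  nlinarith [mul_nonneg this.le hv]

theorem eventually_quarter_le_log_expression (M c : ℝ) :
    ∀ᶠ L : ℝ in atTop,
      L / 4 ≤ 1 / 2 * L - 5 / 4 * Real.log L - c - M * L ^ ((1 : ℝ) / 4) := by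
  have h1 : Tendsto (fun L : ℝ => Real.log L / L) atTop (𝓝 0) :=
    Real.isLittleO_log_id_atTop.tendsto_div_nhds_zero
  have h2 : Tendsto (fun L : ℝ => L ^ ((1 : ℝ) / 4) / L) atTop (𝓝 0) := by
    refine (tendsto_rpow_neg_atTop (show (0 : ℝ) < 3 / 4 by norm_num)).congr' ?_
    filter_upwards [eventually_gt_atTop 0] with L hL
    rw [← Real.rpow_sub_one hL.ne']
    norm_num
  have h3 : Tendsto (fun L : ℝ => c / L) atTop (𝓝 0) := tendsto_id.const_div_atTop c
  have h := ((h1.const_mul (5 / 4)).add h3).add (h2.const_mul M)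
  simp only [mul_zero, add_zero] at h
  filter_upwards [h.eventually_le_const (show (0 : ℝ) < 1 / 4 by norm_num),
    eventually_gt_atTop 0] with L hL hL0
  have := mul_le_mul_of_nonneg_right hL hL0.le
  have e : (5 / 4 * (Real.log L / L) + c / L + M * (L ^ ((1 : ℝ) / 4) / L)) * L =
      5 / 4 * Real.log L + c + M * L ^ ((1 : ℝ) / 4) := by field_simp
  linarith

theorem eventually_hSeq_lower_bounds (v : ℕ → ℕ) {M : ℝ} (hM : 0 < M) :
    ∀ᶠ n : ℕ in atTop, ∀ t : ℝ, |t| ≤ M * Real.log n ^ ((1 : ℝ) / 4) →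
      0 < hSeq v n t ∧ 1 ≤ sSeq v n * hSeq v n t ∧ 1 ≤ sSeq v n * hSeq v n t ^ 2 := by
  have hlog : Tendsto (fun n : ℕ => Real.log n) atTop atTop :=
    Real.tendsto_log_atTop.comp tendsto_natCast_atTop_atTop
  have hle : ∀ᶠ n : ℕ in atTop, Real.log n ≤ Real.log (sSeq v n) := by
    filter_upwards [eventually_gt_atTop 0] with n hn
    have : (0 : ℝ) < n := by exact_mod_cast hn
    exact Real.log_le_log this (by linarith [two_mul_le_sSeq v hn])
  have hL : Tendsto (fun n : ℕ => Real.log (sSeq v n)) atTop atTop :=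
    tendsto_atTop_mono' _ hle hlog
  filter_upwards [hle, eventually_gt_atTop 0, hL.eventually_ge_atTop 32,
    hL.eventually (eventually_quarter_le_log_expression M
      (Real.log ((2 : ℝ) ^ ((1 : ℝ) / 4) * Real.pi)))] with n hn hn0 h32 hquarter t ht
  have hn1 : (1 : ℝ) ≤ n := by exact_mod_cast hn0
  have hs1 : 1 ≤ sSeq v n := by linarith [two_mul_le_sSeq v hn0]
  have hpow : M * Real.log n ^ ((1 : ℝ) / 4) ≤ M * Real.log (sSeq v n) ^ ((1 : ℝ) / 4) := by
    have := Real.log_nonneg hn1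
    gcongr
  have hg : Real.log (sSeq v n) / 4 ≤ gammaSeq v n + t := by
    have := neg_abs_le t
    unfold gammaSeq
    linarith
  have hsqrt : 0 < √(2 * sSeq v n * Real.log (sSeq v n)) := Real.sqrt_pos.2 (by positivity)
  have hh : 0 < hSeq v n t := div_pos (by linarith) hsqrt
  have hsq : 1 ≤ sSeq v n * hSeq v n t ^ 2 := by
    rw [hSeq, div_pow, Real.sq_sqrt (by positivity), ← mul_div_assoc,
      one_le_div (by positivity), mul_comm (2 : ℝ), mul_assoc]
    gcongr
    nlinarith
  refine ⟨hh, ?_, hsq⟩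
  have : 0 ≤ sSeq v n * hSeq v n t := by positivity
  nlinarith

/-- Monotonicity and lower bounds for `w(r) = v τ_n(κ_n(1+r))` and its derivative,
in the regime `v ≳ log n`. -/
theorem w_monotone_lower_bounds
    (v : ℕ → ℕ) (c₀ : ℝ) (hc₀ : 0 < c₀)
    (hv : ∀ᶠ n : ℕ in atTop, c₀ * Real.log n ≤ (v n : ℝ)) :
    ∀ M > 0, ∃ C > 0, ∃ N : ℕ, ∀ n ≥ N, ∀ t : ℝ,
      |t| ≤ M * Real.log n ^ ((1:ℝ)/4) →
      (StrictMonoOn (fun r => (v n : ℝ) * tauFun v n (kappaSeq v n t * (1 + r)))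
          (Set.Ici (0:ℝ)) ∧
        StrictMonoOn (deriv fun r => (v n : ℝ) * tauFun v n (kappaSeq v n t * (1 + r)))
          (Set.Ici (0:ℝ))) ∧
      ∀ r > (0:ℝ),
        (v n : ℝ) * tauFun v n (kappaSeq v n t * (1 + r)) ≥
          (v n : ℝ) * tauFun v n (kappaSeq v n t) +
            2 * sSeq v n * hSeq v n t * r * (1 - C * hSeq v n t) ∧
        deriv (fun r => (v n : ℝ) * tauFun v n (kappaSeq v n t * (1 + r))) r ≥
          2 * sSeq v n * hSeq v n t * (1 - C * hSeq v n t) := by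
  intro M hM
  have hlog : Tendsto (fun n : ℕ => Real.log n) atTop atTop :=
    Real.tendsto_log_atTop.comp tendsto_natCast_atTop_atTop
  refine ⟨1, one_pos, ?_⟩
  rw [← eventually_atTop]
  filter_upwards [hv, hlog.eventually_gt_atTop 0, eventually_gt_atTop 0,
    eventually_hSeq_lower_bounds v hM] with n hvn hlogn hn hbounds t ht
  obtain ⟨hh, hsh, hshh⟩ := hbounds t ht
  have hm : (0 : ℝ) < v n := (mul_pos hc₀ hlogn).trans_le hvn
  have hvpos : 0 < v n := by exact_mod_cast hm
  have hN : (0 : ℝ) < n := by exact_mod_cast hn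
  have hk : 0 < kappaSeq v n t := by unfold kappaSeq; positivity
  have hderiv (r : ℝ) (hr : 0 ≤ r) := hasDerivAt_scaled_tauFun v n hvpos hk
    (show 0 < 1 + r by linarith)
  set w := fun r => (v n : ℝ) * tauFun v n (kappaSeq v n t * (1 + r)) with hw
  have hmono' : StrictMonoOn (deriv w) (Set.Ici 0) := by
    intro x hx y hy hxy
    rw [Set.mem_Ici] at hx hy
    rw [(hderiv x hx).deriv, (hderiv y hy).deriv]
    exact scaledTauDeriv_strictMonoOn hm (by linarith) (Set.mem_Ioi.2 (by linarith))
      (Set.mem_Ioi.2 (by linarith)) (by linarith)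
  have hzero : 2 * sSeq v n * hSeq v n t - 1 ≤ deriv w 0 := by
    rw [(hderiv 0 le_rfl).deriv, add_zero]
    exact scaledTauDeriv_one_lower_bound hN hm hh.le
  have hlower (r : ℝ) (hr : 0 ≤ r) : 2 * sSeq v n * hSeq v n t - 1 ≤ deriv w r :=
    hzero.trans (hmono'.monotoneOn Set.self_mem_Ici hr hr)
  have hcont : ContinuousOn w (Set.Ici 0) := fun r hr =>
    (hderiv r hr).continuousAt.continuousWithinAt
  have hbound : 2 * sSeq v n * hSeq v n t * (1 - 1 * hSeq v n t) ≤
      2 * sSeq v n * hSeq v n t - 1 := by nlinarith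
  refine ⟨⟨strictMonoOn_of_deriv_pos (convex_Ici 0) hcont fun r hr => ?_, hmono'⟩,
    fun r hr => ⟨?_, hbound.trans (hlower r hr.le)⟩⟩
  · rw [interior_Ici] at hr
    have := hlower r (Set.mem_Ioi.1 hr).le
    linarith
  · have hmvt := (convex_Ici (0 : ℝ)).mul_sub_le_image_sub_of_le_deriv hcont
      (fun x hx => (hderiv x (interior_subset hx)).differentiableAt.differentiableWithinAt)
      (fun x hx => hlower x (interior_subset hx)) 0 Set.self_mem_Ici r hr.le hr.le
    have hw0 : w 0 = (v n : ℝ) * tauFun v n (kappaSeq v n t) := by simp [hw]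
    have := mul_le_mul_of_nonneg_right hbound hr.le
    change _ ≤ w r
    rw [← hw0]
    linarith
end
end

section
/- Let (u_n), (δ_n), (h_n) be sequences of positive reals with u_n/√(n·log n) → a, δ_n/((log n)/n)^{1/4} → b, and h_n·√(n/log n) → c₀, where a, b, c₀ > 0 are constants, and let k, c₁, c₂ > 0 be constants. Then there exist C > 0 and N such that for all n ≥ N, | ∫_0^{δ_n} exp(−u_n y² − c₁ n y⁴)·(1 + y²/(c₂ h_n))^{−k} dy − √π/(2√u_n) | ≤ (C/log n)·√π/(2√u_n). -/
open Filter Topology MeasureTheory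

noncomputable section

lemma sub_le_exp_mul_one_add_rpow {s t k : ℝ} (ht : 0 ≤ t) (hk : 0 ≤ k) :
    1 - (s + k * t) ≤ Real.exp (-s) * (1 + t) ^ (-k) := by
  have h1 : Real.log (1 + t) ≤ t := by
    have := Real.log_le_sub_one_of_pos (show 0 < 1 + t by linarith)
    linarith
  rw [Real.rpow_def_of_pos (by linarith), ← Real.exp_add]
  have h2 := Real.add_one_le_exp (-s + Real.log (1 + t) * -k)
  nlinarith [mul_le_mul_of_nonneg_left h1 hk]

lemma exp_mul_one_add_rpow_le_one {s t k : ℝ} (hs : 0 ≤ s) (ht : 0 ≤ t) (hk : 0 ≤ k) :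
    Real.exp (-s) * (1 + t) ^ (-k) ≤ 1 :=
  mul_le_one₀ (Real.exp_le_one_iff.2 (by linarith)) (Real.rpow_nonneg (by linarith) _)
    (Real.rpow_le_one_of_one_le_of_nonpos (by linarith) (by linarith))

lemma laplace_integrand_error_le {u p q k y : ℝ} (hu : 0 < u) (hp : 0 ≤ p) (hq : 0 < q)
    (hk : 0 ≤ k) :
    |Real.exp (-u * y ^ 2 - p * y ^ 4) * (1 + y ^ 2 / q) ^ (-k) - Real.exp (-u * y ^ 2)| ≤
      (8 * p / u ^ 2 + 2 * k / (q * u)) * Real.exp (-(u / 2) * y ^ 2) := by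
  have ht : 0 ≤ y ^ 2 / q := by positivity
  have hs : 0 ≤ p * y ^ 4 := by positivity
  have hlow := sub_le_exp_mul_one_add_rpow (s := p * y ^ 4) ht hk
  have hup := exp_mul_one_add_rpow_le_one hs ht hk
  have hfac : Real.exp (-u * y ^ 2 - p * y ^ 4) * (1 + y ^ 2 / q) ^ (-k) =
      Real.exp (-u * y ^ 2) * (Real.exp (-(p * y ^ 4)) * (1 + y ^ 2 / q) ^ (-k)) := by
    rw [← mul_assoc, ← Real.exp_add]; ring_nf
  set x := u / 2 * y ^ 2 with hx
  have hx0 : 0 ≤ x := by positivity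
  have hsq : Real.exp (-u * y ^ 2) = Real.exp (-(u / 2) * y ^ 2) * Real.exp (-x) := by
    rw [← Real.exp_add, hx]; ring_nf
  have hquad := Real.quadratic_le_exp_of_nonneg hx0
  have hbound : p * y ^ 4 + k * (y ^ 2 / q) ≤
      (8 * p / u ^ 2 + 2 * k / (q * u)) * Real.exp x := by
    have e1 : p * y ^ 4 + k * (y ^ 2 / q) =
        8 * p / u ^ 2 * (x ^ 2 / 2) + 2 * k / (q * u) * x := by
      rw [hx]; field_simp; ring
    rw [e1, add_mul]
    gcongr <;> nlinarith
  rw [hfac, abs_sub_comm, abs_of_nonneg (by nlinarith [Real.exp_pos (-u * y ^ 2)])]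
  calc Real.exp (-u * y ^ 2) -
        Real.exp (-u * y ^ 2) * (Real.exp (-(p * y ^ 4)) * (1 + y ^ 2 / q) ^ (-k))
      ≤ Real.exp (-u * y ^ 2) * (p * y ^ 4 + k * (y ^ 2 / q)) := by
        nlinarith [Real.exp_pos (-u * y ^ 2)]
    _ ≤ Real.exp (-u * y ^ 2) * ((8 * p / u ^ 2 + 2 * k / (q * u)) * Real.exp x) := by gcongr
    _ = (8 * p / u ^ 2 + 2 * k / (q * u)) * Real.exp (-(u / 2) * y ^ 2) *
          (Real.exp (-x) * Real.exp x) := by rw [hsq]; ring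
    _ = _ := by rw [← Real.exp_add]; simp

lemma exp_neg_mul_sq_le_of_lt {u δ y : ℝ} (hu : 0 < u) (hδ : 0 < δ) (hy : δ < y) :
    Real.exp (-u * y ^ 2) ≤ 2 / (u * δ ^ 2) * Real.exp (-(u / 2) * y ^ 2) := by
  have hsq : Real.exp (-u * y ^ 2) =
      Real.exp (-(u / 2 * y ^ 2)) * Real.exp (-(u / 2) * y ^ 2) := by
    rw [← Real.exp_add]; ring_nf
  rw [hsq]
  gcongr
  rw [Real.exp_neg, inv_le_comm₀ (Real.exp_pos _) (by positivity), inv_div]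
  have h1 := Real.add_one_le_exp (u / 2 * y ^ 2)
  have h2 : u / 2 * δ ^ 2 ≤ u / 2 * y ^ 2 := by gcongr
  linarith

lemma laplace_integral_error_le {u p q k δ : ℝ} (hu : 0 < u) (hp : 0 ≤ p) (hq : 0 < q)
    (hk : 0 ≤ k) (hδ : 0 < δ) :
    |(∫ y in Set.Ioc (0 : ℝ) δ, Real.exp (-u * y ^ 2 - p * y ^ 4) * (1 + y ^ 2 / q) ^ (-k)) -
        Real.sqrt Real.pi / (2 * Real.sqrt u)| ≤
      (8 * p / u ^ 2 + 2 * k / (q * u) + 2 / (u * δ ^ 2)) * Real.sqrt 2 *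
        (Real.sqrt Real.pi / (2 * Real.sqrt u)) := by
  set f : ℝ → ℝ := fun y ↦ Real.exp (-u * y ^ 2 - p * y ^ 4) * (1 + y ^ 2 / q) ^ (-k) with hf
  set M := 8 * p / u ^ 2 + 2 * k / (q * u) + 2 / (u * δ ^ 2) with hM
  have hcont : Continuous f := by
    refine Continuous.mul (by fun_prop) (Continuous.rpow_const (by fun_prop) fun y ↦ Or.inl ?_)
    positivity
  have hfi : IntegrableOn f (Set.Ioc 0 δ) :=
    (hcont.integrableOn_Icc (a := 0) (b := δ)).mono_set Set.Ioc_subset_Icc_self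
  have hFi : IntegrableOn ((Set.Ioc 0 δ).indicator f) (Set.Ioi 0) :=
    ((integrable_indicator_iff measurableSet_Ioc).2 hfi).integrableOn
  have hgi : IntegrableOn (fun y ↦ Real.exp (-u * y ^ 2)) (Set.Ioi 0) :=
    (integrable_exp_neg_mul_sq hu).integrableOn
  have hGi : IntegrableOn (fun y ↦ M * Real.exp (-(u / 2) * y ^ 2)) (Set.Ioi 0) :=
    ((integrable_exp_neg_mul_sq (half_pos hu)).const_mul M).integrableOn
  have hIf : ∫ y in Set.Ioc (0 : ℝ) δ, f y =
      ∫ y in Set.Ioi (0 : ℝ), (Set.Ioc 0 δ).indicator f y := by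
    rw [setIntegral_indicator measurableSet_Ioc,
      Set.inter_eq_self_of_subset_right Set.Ioc_subset_Ioi_self]
  have hIg : Real.sqrt Real.pi / (2 * Real.sqrt u) =
      ∫ y in Set.Ioi (0 : ℝ), Real.exp (-u * y ^ 2) := by
    rw [integral_gaussian_Ioi, Real.sqrt_div Real.pi_nonneg, div_div, mul_comm]
  have hIG : M * Real.sqrt 2 * (Real.sqrt Real.pi / (2 * Real.sqrt u)) =
      ∫ y in Set.Ioi (0 : ℝ), M * Real.exp (-(u / 2) * y ^ 2) := by
    rw [integral_const_mul, integral_gaussian_Ioi, Real.sqrt_div Real.pi_nonneg,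
      Real.sqrt_div hu.le]
    have := Real.sqrt_pos.2 hu
    field_simp
  rw [hIf, hIG, hIg, ← integral_sub hFi hgi, ← Real.norm_eq_abs]
  refine norm_integral_le_of_norm_le hGi ?_
  filter_upwards [ae_restrict_mem measurableSet_Ioi] with y hy
  rw [Real.norm_eq_abs]
  have hE := Real.exp_pos (-(u / 2) * y ^ 2)
  by_cases hyδ : y ≤ δ
  · rw [Set.indicator_of_mem (show y ∈ Set.Ioc 0 δ from ⟨hy, hyδ⟩)]
    refine (laplace_integrand_error_le hu hp hq hk).trans ?_
    gcongr
    rw [hM]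
    exact le_add_of_nonneg_right (by positivity)
  · rw [Set.indicator_of_notMem fun hmem ↦ hyδ hmem.2, zero_sub, abs_neg, Real.abs_exp]
    refine (exp_neg_mul_sq_le_of_lt hu hδ (not_le.1 hyδ)).trans ?_
    gcongr
    rw [hM]
    exact le_add_of_nonneg_left (by positivity)

/-- Laplace-type integral asymptotics:
`∫_0^{δ_n} e^{−u_n y² − c₁ n y⁴}(1 + y²/(c₂ h_n))^{−k} dy = (√π/(2√u_n))(1 + O(1/log n))`. -/
theorem laplace_integral_asymptotics
    (u δ h : ℕ → ℝ) (hu : ∀ n, 0 < u n) (hδ : ∀ n, 0 < δ n) (hh : ∀ n, 0 < h n)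
    (a b c₀ : ℝ) (ha : 0 < a) (hb : 0 < b) (hc₀ : 0 < c₀)
    (hua : Tendsto (fun n : ℕ => u n / Real.sqrt ((n : ℝ) * Real.log n)) atTop (𝓝 a))
    (hdb : Tendsto (fun n : ℕ => δ n / (Real.log n / n) ^ ((1:ℝ)/4)) atTop (𝓝 b))
    (hhc : Tendsto (fun n : ℕ => h n * Real.sqrt ((n : ℝ) / Real.log n)) atTop (𝓝 c₀))
    (k c₁ c₂ : ℝ) (hk : 0 < k) (hc₁ : 0 < c₁) (hc₂ : 0 < c₂) :
    ∃ C > 0, ∃ N : ℕ, ∀ n ≥ N,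
      |(∫ y in Set.Ioc (0:ℝ) (δ n),
          Real.exp (-(u n) * y ^ 2 - c₁ * n * y ^ 4) *
            (1 + y ^ 2 / (c₂ * h n)) ^ (-k)) -
        Real.sqrt Real.pi / (2 * Real.sqrt (u n))| ≤
      (C / Real.log n) * (Real.sqrt Real.pi / (2 * Real.sqrt (u n))) := by
  set A : ℕ → ℝ := fun n ↦ u n / Real.sqrt ((n : ℝ) * Real.log n) with hA
  set B : ℕ → ℝ := fun n ↦ δ n / (Real.log n / n) ^ ((1 : ℝ) / 4) with hB
  set H : ℕ → ℝ := fun n ↦ h n * Real.sqrt ((n : ℝ) / Real.log n) with hH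
  set M : ℕ → ℝ := fun n ↦ 8 * c₁ / A n ^ 2 + 2 * k / (c₂ * (A n * H n)) +
    2 / (A n * B n ^ 2) with hM
  have hMlim : Tendsto M atTop
      (𝓝 (8 * c₁ / a ^ 2 + 2 * k / (c₂ * (a * c₀)) + 2 / (a * b ^ 2))) :=
    ((tendsto_const_nhds.div (hua.pow 2) (by positivity)).add
      (tendsto_const_nhds.div ((hua.mul hhc).const_mul c₂) (by positivity))).add
      (tendsto_const_nhds.div (hua.mul (hdb.pow 2)) (by positivity))
  set K := 8 * c₁ / a ^ 2 + 2 * k / (c₂ * (a * c₀)) + 2 / (a * b ^ 2) with hK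
  have hKpos : 0 < K := by positivity
  have hev := hMlim.eventually_le_const (lt_add_one K)
  obtain ⟨N, hN⟩ := eventually_atTop.1 (hev.and (eventually_ge_atTop 2))
  refine ⟨(K + 1) * Real.sqrt 2, by positivity, N, fun n hn ↦ ?_⟩
  obtain ⟨hMn, hn2⟩ := hN n hn
  have hn2' : (2 : ℝ) ≤ n := by exact_mod_cast hn2
  have hnpos : (0 : ℝ) < n := by linarith
  have hL : 0 < Real.log n := Real.log_pos (by linarith)
  have hmain := laplace_integral_error_le (p := c₁ * n) (hu n) (by positivity)
    (mul_pos hc₂ (hh n)) hk.le (hδ n)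
  refine hmain.trans ?_
  gcongr
  have hun := hu n
  have hδn := hδ n
  have hhn := hh n
  have hs : 0 < Real.sqrt n := Real.sqrt_pos.2 hnpos
  have hl : 0 < Real.sqrt (Real.log n) := Real.sqrt_pos.2 hL
  have hs2 : Real.sqrt n ^ 2 = n := Real.sq_sqrt hnpos.le
  have hl2 : Real.sqrt (Real.log n) ^ 2 = Real.log n := Real.sq_sqrt hL.le
  have hA2 : A n ^ 2 = u n ^ 2 / (n * Real.log n) := by
    rw [hA, div_pow, Real.sq_sqrt (by positivity)]
  have hAH : A n * H n = u n * h n / Real.log n := by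
    simp only [hA, hH]
    rw [Real.sqrt_mul hnpos.le, Real.sqrt_div hnpos.le]
    field_simp
    rw [hl2]
  have hAB : A n * B n ^ 2 = u n * δ n ^ 2 / Real.log n := by
    have hr : ((Real.log n / n) ^ ((1 : ℝ) / 4)) ^ 2 = Real.sqrt (Real.log n) / Real.sqrt n := by
      rw [← Real.rpow_natCast, ← Real.rpow_mul (by positivity), ← Real.sqrt_div hL.le,
        Real.sqrt_eq_rpow]
      norm_num
    simp only [hA, hB]
    rw [div_pow, hr, Real.sqrt_mul hnpos.le]
    field_simp
    rw [hl2]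
  have hMeq : 8 * (c₁ * n) / u n ^ 2 + 2 * k / (c₂ * h n * u n) + 2 / (u n * δ n ^ 2) =
      M n / Real.log n := by
    simp only [hM]
    rw [hA2, hAH, hAB]
    field_simp
  rw [hMeq, mul_div_right_comm]
  gcongr
end
end
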